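/- For every database x ∈ [0,1]^n and every discretized database x̂ ∈ D_k^n with |x_i − x̂_i| ≤ 2^{−k} for all i, the discretize-then-perturb scheme satisfies E_{Y∼E(x̂)}[(q̂_φ(Y) − q_φ(x))²] ≤ L²/(c²·2^{2k}) + 2(b−a)(1+(2^k−1)e^{−ε})·L/(c²(1−e^{−ε})·2^k·√n) + 4(b−a)²(1+(2^k−1)e^{−ε})²/(c²(1−e^{−ε})²·n). -/

import Mathlib

open Finset

/-- A discretized database: `n` rows in the discretized universe `D_k` of size `2^k`. -/
abbrev DbK (k n : ℕ) := Fin n → Fin (2 ^ k)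

/-- The embedding of `D_k = {0, 1/2^k, …, (2^k-1)/2^k}` into `[0,1]`. -/
noncomputable def emb (k : ℕ) (v : Fin (2 ^ k)) : ℝ := (v : ℝ) / 2 ^ k

/-- Hamming distance on `D_k^n`. -/
def hamK {k n : ℕ} (x y : DbK k n) : ℕ :=
  (Finset.univ.filter fun i => x i ≠ y i).card

/-- The pmf of the mechanism `E` on `D_k^n`. -/
noncomputable def pEK (k : ℕ) (ε : ℝ) {n : ℕ} (x y : DbK k n) : ℝ :=
  Real.exp (-ε * (hamK x y : ℝ)) / (1 + ((2:ℝ) ^ k - 1) * Real.exp (-ε)) ^ n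

/-- `a_i = min_{v ∈ D_k} φ_i(v)`. -/
noncomputable def AminK {n : ℕ} (k : ℕ) (φ : Fin n → ℝ → ℝ) (i : Fin n) : ℝ :=
  Finset.univ.inf' Finset.univ_nonempty (fun v : Fin (2 ^ k) => φ i (emb k v))

/-- `b_i = max_{v ∈ D_k} φ_i(v)`. -/
noncomputable def BmaxK {n : ℕ} (k : ℕ) (φ : Fin n → ℝ → ℝ) (i : Fin n) : ℝ :=
  Finset.univ.sup' Finset.univ_nonempty (fun v : Fin (2 ^ k) => φ i (emb k v))

/-- The statistical query on a continuous database `u ∈ [0,1]^n`. -/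
noncomputable def qC {n : ℕ} (k : ℕ) (φ : Fin n → ℝ → ℝ) (u : Fin n → ℝ) : ℝ :=
  (∑ i, φ i (u i)) / (∑ i, (BmaxK k φ i - AminK k φ i))

/-- The statistical query on a discretized database `y ∈ D_k^n`. -/
noncomputable def qD {n : ℕ} (k : ℕ) (φ : Fin n → ℝ → ℝ) (y : DbK k n) : ℝ :=
  (∑ i, φ i (emb k (y i))) / (∑ i, (BmaxK k φ i - AminK k φ i))

/-- `C_φ = (∑ i ∑_{v ∈ D_k} φ_i(v)) / (∑ i c_i)`. -/
noncomputable def CphiK {n : ℕ} (k : ℕ) (φ : Fin n → ℝ → ℝ) : ℝ :=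
  (∑ i, ∑ v : Fin (2 ^ k), φ i (emb k v)) / (∑ i, (BmaxK k φ i - AminK k φ i))

/-- The unbiased companion estimator on `D_k^n`. -/
noncomputable def qhatuK {n : ℕ} (k : ℕ) (ε : ℝ) (φ : Fin n → ℝ → ℝ) (y : DbK k n) : ℝ :=
  ((1 + ((2:ℝ) ^ k - 1) * Real.exp (-ε)) / (1 - Real.exp (-ε))) * qD k φ y
    - (Real.exp (-ε) / (1 - Real.exp (-ε))) * CphiK k φ

/-- The second moment of a sum of centred one-coordinate functions under a product weight. -/
lemma sum_pi_prod_mul_sq {n : ℕ} {α : Type*} [Fintype α] [DecidableEq α]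
    (p f : Fin n → α → ℝ) (hp : ∀ i, ∑ v, p i v = 1) (hf : ∀ i, ∑ v, p i v * f i v = 0) :
    ∑ y : Fin n → α, (∏ i, p i (y i)) * (∑ i, f i (y i)) ^ 2
      = ∑ i, ∑ v, p i v * f i v ^ 2 := by
  have key : ∀ i j, ∑ y : Fin n → α, (∏ l, p l (y l)) * (f i (y i) * f j (y j))
      = if i = j then ∑ v, p i v * f i v ^ 2 else 0 := by
    intro i j
    have h1 : ∀ y : Fin n → α, (∏ l, p l (y l)) * (f i (y i) * f j (y j))
        = ∏ l, (p l (y l) * ((if l = i then f l (y l) else 1)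
            * (if l = j then f l (y l) else 1))) := by
      intro y
      rw [Finset.prod_mul_distrib, Finset.prod_mul_distrib]
      simp
    rw [Finset.sum_congr rfl fun y _ => h1 y,
      ← Fintype.prod_sum fun l v => p l v * ((if l = i then f l v else 1)
        * (if l = j then f l v else 1))]
    split_ifs with hij
    · subst hij
      rw [Finset.prod_eq_single i]
      · simp [sq]
      · intro l _ hl
        simp [hl, hp]
      · simp
    · apply Finset.prod_eq_zero (Finset.mem_univ i)
      simp [hij, hf]
  simp_rw [sq (∑ i, f i _), Finset.sum_mul_sum, Finset.mul_sum]
  rw [Finset.sum_comm]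
  refine Finset.sum_congr rfl fun i _ => ?_
  rw [Finset.sum_comm]
  simp [key]

/-- The law of a single row of the mechanism. -/
noncomputable def rowWeight (k : ℕ) (ε : ℝ) (u v : Fin (2 ^ k)) : ℝ :=
  (if u = v then 1 else Real.exp (-ε)) / (1 + ((2:ℝ) ^ k - 1) * Real.exp (-ε))

lemma pEK_eq_prod (k : ℕ) (ε : ℝ) {n : ℕ} (x y : DbK k n) :
    pEK k ε x y = ∏ i, rowWeight k ε (x i) (y i) := by
  unfold pEK rowWeight hamK
  rw [Finset.prod_div_distrib, Finset.prod_const, Finset.card_univ, Fintype.card_fin]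
  congr 1
  rw [mul_comm, Real.exp_nat_mul, Finset.prod_ite, Finset.prod_const_one, one_mul,
    Finset.prod_const]

lemma normalizer_pos (k : ℕ) (ε : ℝ) : 0 < 1 + ((2:ℝ) ^ k - 1) * Real.exp (-ε) := by
  have h : (1:ℝ) ≤ 2 ^ k := one_le_pow₀ (by norm_num)
  have := mul_nonneg (sub_nonneg.2 h) (Real.exp_pos (-ε)).le
  linarith

lemma rowWeight_nonneg (k : ℕ) (ε : ℝ) (u v : Fin (2 ^ k)) : 0 ≤ rowWeight k ε u v := by
  unfold rowWeight
  have := normalizer_pos k ε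
  have := Real.exp_pos (-ε)
  split_ifs <;> positivity

/-- The mean of a function of a single perturbed row. -/
lemma sum_rowWeight_mul (k : ℕ) (ε : ℝ) (u : Fin (2 ^ k)) (h : Fin (2 ^ k) → ℝ) :
    ∑ v, rowWeight k ε u v * h v
      = ((1 - Real.exp (-ε)) * h u + Real.exp (-ε) * ∑ v, h v)
          / (1 + ((2:ℝ) ^ k - 1) * Real.exp (-ε)) := by
  have h1 : ∀ v, rowWeight k ε u v * h v
      = ((if u = v then (1 - Real.exp (-ε)) * h v else 0) + Real.exp (-ε) * h v)
          / (1 + ((2:ℝ) ^ k - 1) * Real.exp (-ε)) := by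
    intro v
    unfold rowWeight
    split_ifs <;> ring
  rw [Finset.sum_congr rfl fun v _ => h1 v, ← Finset.sum_div, Finset.sum_add_distrib,
    ← Finset.mul_sum]
  simp

lemma sum_rowWeight (k : ℕ) (ε : ℝ) (u : Fin (2 ^ k)) : ∑ v, rowWeight k ε u v = 1 := by
  have h := sum_rowWeight_mul k ε u fun _ => 1
  simp only [mul_one, Finset.sum_const, Finset.card_univ, Fintype.card_fin, nsmul_eq_mul] at h
  rw [h, div_eq_one_iff_eq (normalizer_pos k ε).ne']
  push_cast
  ring

/-- Popoviciu's inequality for a finitely supported law. -/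
lemma sum_mul_sub_sq_le {α : Type*} [Fintype α] (p h : α → ℝ) (hp0 : ∀ v, 0 ≤ p v)
    (hp : ∑ v, p v = 1) (a b : ℝ) (ha : ∀ v, a ≤ h v) (hb : ∀ v, h v ≤ b) (μ : ℝ)
    (hμ : ∑ v, p v * h v = μ) : ∑ v, p v * (h v - μ) ^ 2 ≤ (b - a) ^ 2 / 4 := by
  have h1 : ∑ v, p v * (h v - (a + b) / 2) ^ 2
      = ∑ v, p v * (h v - μ) ^ 2 + (μ - (a + b) / 2) ^ 2 := by
    have : ∀ v, p v * (h v - (a + b) / 2) ^ 2 = p v * (h v - μ) ^ 2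
        + (2 * (μ - (a + b) / 2) * (p v * h v)
          + (((a + b) / 2) ^ 2 - μ ^ 2) * p v) := fun v => by ring
    rw [Finset.sum_congr rfl fun v _ => this v, Finset.sum_add_distrib, Finset.sum_add_distrib,
      ← Finset.mul_sum, ← Finset.mul_sum, hμ, hp]
    ring
  have h2 : ∑ v, p v * (h v - (a + b) / 2) ^ 2 ≤ ∑ v, p v * ((b - a) ^ 2 / 4) := by
    refine Finset.sum_le_sum fun v _ => mul_le_mul_of_nonneg_left ?_ (hp0 v)
    nlinarith [mul_nonneg (sub_nonneg.2 (ha v)) (sub_nonneg.2 (hb v))]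
  rw [← Finset.sum_mul, hp, one_mul] at h2
  nlinarith [sq_nonneg (μ - (a + b) / 2)]

lemma sum_pEK (k : ℕ) (ε : ℝ) {n : ℕ} (x : DbK k n) : ∑ y, pEK k ε x y = 1 := by
  simp_rw [pEK_eq_prod]
  rw [← Fintype.prod_sum fun i v => rowWeight k ε (x i) v]
  simp [sum_rowWeight]

lemma pEK_nonneg (k : ℕ) (ε : ℝ) {n : ℕ} (x y : DbK k n) : 0 ≤ pEK k ε x y := by
  rw [pEK_eq_prod]
  exact Finset.prod_nonneg fun i _ => rowWeight_nonneg k ε _ _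

/-- The deviation of the unbiased companion estimator as a sum of centred rows. -/
lemma qhatuK_sub_qD {n : ℕ} (k : ℕ) {ε : ℝ} (hε : 0 < ε) (φ : Fin n → ℝ → ℝ) (x y : DbK k n) :
    qhatuK k ε φ y - qD k φ x
      = (1 + ((2:ℝ) ^ k - 1) * Real.exp (-ε))
          / ((1 - Real.exp (-ε)) * ∑ i, (BmaxK k φ i - AminK k φ i))
        * ∑ i, (φ i (emb k (y i)) - ∑ v, rowWeight k ε (x i) v * φ i (emb k v)) := by
  have hg := (normalizer_pos k ε).ne'
  have he : 1 - Real.exp (-ε) ≠ 0 := by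
    have : Real.exp (-ε) < 1 := by simpa using hε
    linarith
  have hs : ∀ i, ∑ v, rowWeight k ε (x i) v * φ i (emb k v)
      = ((1 - Real.exp (-ε)) * φ i (emb k (x i)) + Real.exp (-ε) * ∑ v, φ i (emb k v))
          / (1 + ((2:ℝ) ^ k - 1) * Real.exp (-ε)) :=
    fun i => sum_rowWeight_mul k ε (x i) fun v => φ i (emb k v)
  unfold qhatuK qD CphiK
  simp_rw [hs]
  generalize ∑ i, (BmaxK k φ i - AminK k φ i) = S
  rw [Finset.sum_sub_distrib, ← Finset.sum_div, Finset.sum_add_distrib, ← Finset.mul_sum,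
    ← Finset.mul_sum, ← div_div]
  generalize 1 + ((2:ℝ) ^ k - 1) * Real.exp (-ε) = g at *
  rw [div_eq_mul_inv _ S, div_eq_mul_inv _ S, div_eq_mul_inv _ S, div_eq_mul_inv _ S]
  field_simp
  ring

/-- The variance bound for the unbiased companion estimator. -/
lemma variance_qhatuK_le {n : ℕ} (k : ℕ) {ε : ℝ} (hε : 0 < ε) (hn : 1 ≤ n) (φ : Fin n → ℝ → ℝ)
    {a b c : ℝ} (hc : 0 < c)
    (hq : ∀ i, a ≤ AminK k φ i ∧ AminK k φ i < BmaxK k φ i ∧ BmaxK k φ i ≤ b ∧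
      c ≤ BmaxK k φ i - AminK k φ i) (x : DbK k n) :
    ∑ y, pEK k ε x y * (qhatuK k ε φ y - qD k φ x) ^ 2
      ≤ ((b - a) * (1 + ((2:ℝ) ^ k - 1) * Real.exp (-ε))
          / (c * (1 - Real.exp (-ε)) * Real.sqrt n)) ^ 2 / 4 := by
  have hg := normalizer_pos k ε
  have he : 0 < 1 - Real.exp (-ε) := by
    have : Real.exp (-ε) < 1 := by simpa using hε
    linarith
  have hn0 : (0:ℝ) < n := by exact_mod_cast hn
  have hS : (n:ℝ) * c ≤ ∑ i, (BmaxK k φ i - AminK k φ i) := by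
    simpa using Finset.card_nsmul_le_sum Finset.univ _ c fun i _ => (hq i).2.2.2
  simp_rw [qhatuK_sub_qD k hε φ x]
  have hlow : ∀ i (v : Fin (2 ^ k)), a ≤ φ i (emb k v) := fun i v =>
    (hq i).1.trans (Finset.inf'_le (fun v : Fin (2 ^ k) => φ i (emb k v)) (Finset.mem_univ v))
  have hupp : ∀ i (v : Fin (2 ^ k)), φ i (emb k v) ≤ b := fun i v =>
    (Finset.le_sup' (fun v : Fin (2 ^ k) => φ i (emb k v)) (Finset.mem_univ v)).trans
      (hq i).2.2.1
  have hvar := sum_pi_prod_mul_sq (fun i v => rowWeight k ε (x i) v)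
    (fun i v => φ i (emb k v) - ∑ w, rowWeight k ε (x i) w * φ i (emb k w))
    (fun i => sum_rowWeight k ε (x i)) (fun i => by
      simp_rw [mul_sub]
      rw [Finset.sum_sub_distrib, ← Finset.sum_mul, sum_rowWeight, one_mul, sub_self])
  have hbd : ∑ i, ∑ v, rowWeight k ε (x i) v
      * (φ i (emb k v) - ∑ w, rowWeight k ε (x i) w * φ i (emb k w)) ^ 2
      ≤ n * ((b - a) ^ 2 / 4) := by
    simpa using Finset.sum_le_card_nsmul Finset.univ _ ((b - a) ^ 2 / 4) fun i _ =>
      sum_mul_sub_sq_le (rowWeight k ε (x i)) (fun v => φ i (emb k v))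
        (rowWeight_nonneg k ε (x i)) (sum_rowWeight k ε (x i)) a b (hlow i) (hupp i) _ rfl
  simp_rw [pEK_eq_prod, mul_pow, mul_left_comm _ (_ ^ 2)]
  rw [← Finset.mul_sum, hvar]
  generalize ∑ i, (BmaxK k φ i - AminK k φ i) = S at *
  generalize 1 + ((2:ℝ) ^ k - 1) * Real.exp (-ε) = g at *
  generalize 1 - Real.exp (-ε) = d at *
  have hnc : 0 < n * c := mul_pos hn0 hc
  have hcoef : g / (d * S) ≤ g / (d * (n * c)) := by gcongr
  calc _ ≤ (g / (d * (n * c))) ^ 2 * (n * ((b - a) ^ 2 / 4)) := by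
        have : 0 < S := hnc.trans_le hS
        refine mul_le_mul (pow_le_pow_left₀ (by positivity) hcoef 2) hbd ?_ (by positivity)
        exact Finset.sum_nonneg fun i _ => Finset.sum_nonneg fun v _ =>
          mul_nonneg (rowWeight_nonneg k ε _ _) (sq_nonneg _)
    _ = _ := by
        rw [div_pow, div_pow, mul_pow _ (Real.sqrt n), Real.sq_sqrt hn0.le]
        field_simp

/-- Rounding every row moves the answer by at most `L / (c 2^k)`. -/
lemma abs_qD_sub_qC_le {n : ℕ} (k : ℕ) (hn : 1 ≤ n) {L c : ℝ} (hL : 0 < L) (hc : 0 < c)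
    (φ : Fin n → ℝ → ℝ)
    (hLip : ∀ i, ∀ u ∈ Set.Icc (0:ℝ) 1, ∀ v ∈ Set.Icc (0:ℝ) 1, |φ i u - φ i v| ≤ L * |u - v|)
    (hq : ∀ i, c ≤ BmaxK k φ i - AminK k φ i)
    (x : Fin n → ℝ) (hx : ∀ i, x i ∈ Set.Icc (0:ℝ) 1)
    (xh : DbK k n) (hdisc : ∀ i, |x i - emb k (xh i)| ≤ 1 / 2 ^ k) :
    |qD k φ xh - qC k φ x| ≤ L / (c * 2 ^ k) := by
  have hn0 : (0:ℝ) < n := by exact_mod_cast hn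
  have hS : (n:ℝ) * c ≤ ∑ i, (BmaxK k φ i - AminK k φ i) := by
    simpa using Finset.card_nsmul_le_sum Finset.univ _ c fun i _ => hq i
  have hnc : 0 < n * c := mul_pos hn0 hc
  have hemb : ∀ v : Fin (2 ^ k), emb k v ∈ Set.Icc (0:ℝ) 1 := by
    intro v
    refine ⟨by unfold emb; positivity, ?_⟩
    unfold emb
    rw [div_le_one (by positivity)]
    exact_mod_cast v.2.le
  have hrow : ∀ i, |φ i (emb k (xh i)) - φ i (x i)| ≤ L * (1 / 2 ^ k) := fun i =>
    (hLip i _ (hemb _) _ (hx i)).trans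
      (mul_le_mul_of_nonneg_left (by rw [abs_sub_comm]; exact hdisc i) hL.le)
  have hsum : |∑ i, (φ i (emb k (xh i)) - φ i (x i))| ≤ n * (L * (1 / 2 ^ k)) := by
    refine (Finset.abs_sum_le_sum_abs _ _).trans ?_
    simpa using Finset.sum_le_card_nsmul Finset.univ _ _ fun i _ => hrow i
  unfold qD qC
  rw [← sub_div, ← Finset.sum_sub_distrib, abs_div, abs_of_pos (hnc.trans_le hS)]
  calc _ ≤ n * (L * (1 / 2 ^ k)) / (n * c) := div_le_div₀ (by positivity) hsum hnc hS
    _ = _ := by field_simp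

/-- Discretize-then-perturb for a continuous data universe: if `x ∈ [0,1]^n`, `x̂ ∈ D_k^n`
with `|x_i - x̂_i| ≤ 2^{-k}`, the row functions are `L`-Lipschitz on `[0,1]`, and `q̂_φ` is
the proper companion estimator, then the squared error of answering `q_φ(x)` by `q̂_φ(Y)`
with `Y ∼ E(x̂)` is at most
`L²/(c² 2^{2k}) + 2(b-a)(1+(2^k-1)e^{-ε})L/(c²(1-e^{-ε}) 2^k √n) + 4(b-a)²(1+(2^k-1)e^{-ε})²/(c²(1-e^{-ε})² n)`. -/
theorem stmt17 (k n : ℕ) (hk : 1 ≤ k) (hn : 1 ≤ n) (ε : ℝ) (hε : 0 < ε)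
    (L : ℝ) (hL : 0 < L) (a b c : ℝ) (hc : 0 < c)
    (φ : Fin n → ℝ → ℝ)
    (hLip : ∀ i, ∀ u ∈ Set.Icc (0:ℝ) 1, ∀ v ∈ Set.Icc (0:ℝ) 1, |φ i u - φ i v| ≤ L * |u - v|)
    (hq : ∀ i, a ≤ AminK k φ i ∧ AminK k φ i < BmaxK k φ i ∧ BmaxK k φ i ≤ b ∧
      c ≤ BmaxK k φ i - AminK k φ i)
    (qhat : DbK k n → ℝ)
    (hproper : ∀ y : DbK k n, ∃ y0 : DbK k n, qhat y = qD k φ y0)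
    (hmin : ∀ (y y0 : DbK k n), |qhatuK k ε φ y - qhat y| ≤ |qhatuK k ε φ y - qD k φ y0|)
    (x : Fin n → ℝ) (hx : ∀ i, x i ∈ Set.Icc (0:ℝ) 1)
    (xh : DbK k n) (hdisc : ∀ i, |x i - emb k (xh i)| ≤ 1 / 2 ^ k) :
    (∑ y : DbK k n, pEK k ε xh y * (qhat y - qC k φ x) ^ 2)
      ≤ L ^ 2 / (c ^ 2 * 2 ^ (2 * k))
        + 2 * (b - a) * (1 + ((2:ℝ) ^ k - 1) * Real.exp (-ε)) * L
            / (c ^ 2 * (1 - Real.exp (-ε)) * 2 ^ k * Real.sqrt n)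
        + 4 * (b - a) ^ 2 * (1 + ((2:ℝ) ^ k - 1) * Real.exp (-ε)) ^ 2
            / (c ^ 2 * (1 - Real.exp (-ε)) ^ 2 * n) := by
  set g := 1 + ((2:ℝ) ^ k - 1) * Real.exp (-ε) with hgdef
  have hg : 0 < g := normalizer_pos k ε
  have he : 0 < 1 - Real.exp (-ε) := by
    have : Real.exp (-ε) < 1 := by simpa using hε
    linarith
  have hn0 : (0:ℝ) < n := by exact_mod_cast hn
  have hab : 0 < b - a := by
    have := hq ⟨0, hn⟩
    linarith
  have hround := abs_qD_sub_qC_le k hn hL hc φ hLip (fun i => (hq i).2.2.2) x hx xh hdisc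
  have hvar := variance_qhatuK_le k hε hn φ hc hq xh
  rw [← hgdef] at hvar
  set M := (b - a) * g / (c * (1 - Real.exp (-ε)) * Real.sqrt n) with hM
  set δ := L / (c * 2 ^ k) with hδ
  have hδ0 : 0 < δ := by positivity
  have hM0 : 0 < M := by positivity
  -- Use AM-GM weights so that the cross term is controlled by the second moment.
  have hpt : ∀ y, (qhat y - qC k φ x) ^ 2
      ≤ (4 + 4 * δ / M) * (qhatuK k ε φ y - qD k φ xh) ^ 2 + (δ * M + δ ^ 2) := by
    intro y
    have h1 : |qhat y - qC k φ x| ≤ 2 * |qhatuK k ε φ y - qD k φ xh| + δ := by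
      have e : qhat y - qC k φ x = -(qhatuK k ε φ y - qhat y)
          + (qhatuK k ε φ y - qD k φ xh) + (qD k φ xh - qC k φ x) := by ring
      have t := abs_add_three (-(qhatuK k ε φ y - qhat y)) (qhatuK k ε φ y - qD k φ xh)
        (qD k φ xh - qC k φ x)
      rw [← e, abs_neg] at t
      linarith [hmin y xh]
    have h2 : (qhat y - qC k φ x) ^ 2 ≤ (2 * |qhatuK k ε φ y - qD k φ xh| + δ) ^ 2 := by
      rw [← sq_abs]
      exact pow_le_pow_left₀ (abs_nonneg _) h1 2
    rw [← sq_abs (qhatuK k ε φ y - qD k φ xh)]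
    generalize |qhatuK k ε φ y - qD k φ xh| = t at *
    have h3 : (4 + 4 * δ / M) * t ^ 2 + (δ * M + δ ^ 2) - (2 * t + δ) ^ 2
        = δ / M * (2 * t - M) ^ 2 := by
      field_simp
      ring
    have h4 : 0 ≤ δ / M * (2 * t - M) ^ 2 := by positivity
    linarith
  calc ∑ y : DbK k n, pEK k ε xh y * (qhat y - qC k φ x) ^ 2
      ≤ ∑ y : DbK k n, pEK k ε xh y
          * ((4 + 4 * δ / M) * (qhatuK k ε φ y - qD k φ xh) ^ 2 + (δ * M + δ ^ 2)) :=
        Finset.sum_le_sum fun y _ => mul_le_mul_of_nonneg_left (hpt y) (pEK_nonneg k ε xh y)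
    _ = (4 + 4 * δ / M) * (∑ y : DbK k n, pEK k ε xh y
          * (qhatuK k ε φ y - qD k φ xh) ^ 2) + (δ * M + δ ^ 2) := by
        simp_rw [mul_add, mul_left_comm (pEK k ε xh _) (4 + 4 * δ / M)]
        rw [Finset.sum_add_distrib, ← Finset.mul_sum, Finset.sum_add_distrib,
          ← Finset.sum_mul, ← Finset.sum_mul, sum_pEK, one_mul, one_mul]
    _ ≤ (4 + 4 * δ / M) * (M ^ 2 / 4) + (δ * M + δ ^ 2) := by gcongr
    _ = δ ^ 2 + 2 * δ * M + M ^ 2 := by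
        field_simp
        ring
    _ ≤ δ ^ 2 + 2 * δ * M + 4 * M ^ 2 := by nlinarith [sq_nonneg M]
    _ = _ := by
        congr 1
        · congr 1
          · rw [hδ, div_pow, mul_pow, ← pow_mul, mul_comm k 2]
          · rw [hδ, hM]
            field_simp
        · rw [hM, div_pow, mul_pow _ (Real.sqrt n), Real.sq_sqrt hn0.le, mul_pow, mul_pow]
          ring
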